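/- (Approximate Orthogonality.) Let Φ be an m×d real matrix with restricted isometry constant δ_r. Let S and T be disjoint index sets in {1,…,d} whose combined cardinality does not exceed r. Then the spectral norm satisfies ‖Φ_S* Φ_T‖ ≤ δ_r. -/

import Mathlib

/-- The Euclidean (ℓ2) norm of a finitely-indexed real vector. -/
noncomputable def l2 {ι : Type*} [Fintype ι] (v : ι → ℝ) : ℝ :=
  Real.sqrt (∑ i, (v i) ^ 2)

/-- A vector is `s`-sparse if it has at most `s` nonzero coordinates. -/
def Sparse {d : ℕ} (s : ℕ) (v : Fin d → ℝ) : Prop :=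
  {i | v i ≠ 0}.ncard ≤ s

/-- `δ` is a restricted isometry constant of `Φ` at sparsity level `r`:
`(1−δ)‖x‖₂² ≤ ‖Φx‖₂² ≤ (1+δ)‖x‖₂²` for every `r`-sparse `x`. The restricted isometry
constant `δ_r` is the smallest such `δ ≥ 0`. -/
def RICq {m d : ℕ} (Φ : Matrix (Fin m) (Fin d) ℝ) (r : ℕ) (δ : ℝ) : Prop :=
  ∀ v : Fin d → ℝ, Sparse r v →
    (1 - δ) * (l2 v) ^ 2 ≤ (l2 (Φ.mulVec v)) ^ 2 ∧
      (l2 (Φ.mulVec v)) ^ 2 ≤ (1 + δ) * (l2 v) ^ 2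

/-- The column submatrix of `Φ` with columns indexed by `T`. -/
def colSub {m d : ℕ} (Φ : Matrix (Fin m) (Fin d) ℝ) (T : Finset (Fin d)) :
    Matrix (Fin m) {j // j ∈ T} ℝ :=
  Matrix.of fun i j => Φ i j.1

/-- Extension by zero of a vector indexed by a finite set of coordinates. -/
noncomputable def zeroExtend {d : ℕ} (S : Finset (Fin d)) (z : {j // j ∈ S} → ℝ) : Fin d → ℝ :=
  fun i => if h : i ∈ S then z ⟨i, h⟩ else 0

theorem zeroExtend_of_notMem {d : ℕ} {S : Finset (Fin d)} (z : {j // j ∈ S} → ℝ) {i : Fin d}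
    (h : i ∉ S) : zeroExtend S z i = 0 :=
  dif_neg h

theorem zeroExtend_coe {d : ℕ} {S : Finset (Fin d)} (z : {j // j ∈ S} → ℝ) (j : {j // j ∈ S}) :
    zeroExtend S z j = z j :=
  dif_pos j.2

theorem dotProduct_zeroExtend {d : ℕ} (S : Finset (Fin d)) (f : Fin d → ℝ)
    (z : {j // j ∈ S} → ℝ) : f ⬝ᵥ zeroExtend S z = ∑ j : {j // j ∈ S}, f j * z j := by
  have h : ∑ i ∈ S, f i * zeroExtend S z i = ∑ i, f i * zeroExtend S z i :=
    Finset.sum_subset (Finset.subset_univ S) fun i _ hi => by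
      rw [zeroExtend_of_notMem z hi, mul_zero]
  rw [dotProduct, ← h, ← Finset.sum_coe_sort]
  simp only [zeroExtend_coe]

theorem zeroExtend_dotProduct_self {d : ℕ} (S : Finset (Fin d)) (z : {j // j ∈ S} → ℝ) :
    zeroExtend S z ⬝ᵥ zeroExtend S z = z ⬝ᵥ z := by
  rw [dotProduct_zeroExtend, dotProduct]
  simp only [zeroExtend_coe]

theorem zeroExtend_dotProduct_of_disjoint {d : ℕ} {S T : Finset (Fin d)} (h : Disjoint S T)
    (z : {j // j ∈ S} → ℝ) (y : {j // j ∈ T} → ℝ) :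
    zeroExtend S z ⬝ᵥ zeroExtend T y = 0 := by
  rw [dotProduct_zeroExtend]
  refine Finset.sum_eq_zero fun j _ => ?_
  rw [zeroExtend_of_notMem z (Finset.disjoint_right.mp h j.2), zero_mul]

theorem mulVec_zeroExtend {m d : ℕ} (Φ : Matrix (Fin m) (Fin d) ℝ) (S : Finset (Fin d))
    (z : {j // j ∈ S} → ℝ) : Φ.mulVec (zeroExtend S z) = (colSub Φ S).mulVec z := by
  ext i
  exact dotProduct_zeroExtend S (Φ i) z

theorem l2_sq {ι : Type*} [Fintype ι] (v : ι → ℝ) : l2 v ^ 2 = v ⬝ᵥ v := by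
  rw [l2, Real.sq_sqrt (Finset.sum_nonneg fun i _ => sq_nonneg _)]
  simp only [dotProduct, sq]

theorem sparse_smul_zeroExtend_add {d r : ℕ} {S T : Finset (Fin d)} (hcard : S.card + T.card ≤ r)
    (z : {j // j ∈ S} → ℝ) (y : {j // j ∈ T} → ℝ) (a b : ℝ) :
    Sparse r (a • zeroExtend S z + b • zeroExtend T y) := by
  have hsub : {i | (a • zeroExtend S z + b • zeroExtend T y) i ≠ 0} ⊆
      ((S ∪ T : Finset _) : Set _) := by
    intro i hi
    by_contra hn
    simp only [Finset.coe_union, Set.mem_union, Finset.mem_coe, not_or] at hn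
    exact hi (by simp [zeroExtend_of_notMem _ hn.1, zeroExtend_of_notMem _ hn.2])
  refine (Set.ncard_le_ncard hsub (Finset.finite_toSet _)).trans ?_
  rw [Set.ncard_coe_finset]
  exact (Finset.card_union_le S T).trans hcard

/-- Polarization of the restricted isometry inequalities on disjointly supported vectors. -/
theorem RICq.two_mul_dotProduct_le {m d r : ℕ} {Φ : Matrix (Fin m) (Fin d) ℝ} {δ : ℝ}
    (hΦ : RICq Φ r δ) {S T : Finset (Fin d)} (hdisj : Disjoint S T)
    (hcard : S.card + T.card ≤ r) (z : {j // j ∈ S} → ℝ) (y : {j // j ∈ T} → ℝ) (a b : ℝ) :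
    2 * (a * b) * ((colSub Φ S).mulVec z ⬝ᵥ (colSub Φ T).mulVec y) ≤
      δ * (a ^ 2 * (z ⬝ᵥ z) + b ^ 2 * (y ⬝ᵥ y)) := by
  have h₁ := (hΦ _ (sparse_smul_zeroExtend_add hcard z y a b)).2
  have h₂ := (hΦ _ (sparse_smul_zeroExtend_add hcard z y a (-b))).1
  simp only [l2_sq, Matrix.mulVec_add, Matrix.mulVec_smul, mulVec_zeroExtend, add_dotProduct,
    dotProduct_add, smul_dotProduct, dotProduct_smul, zeroExtend_dotProduct_self,
    zeroExtend_dotProduct_of_disjoint hdisj, zeroExtend_dotProduct_of_disjoint hdisj.symm,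
    smul_eq_mul, dotProduct_comm ((colSub Φ T).mulVec y) ((colSub Φ S).mulVec z)] at h₁ h₂
  linarith

/-- **Approximate Orthogonality.** If `δ ≥ 0` satisfies the restricted
isometry inequalities at level `r` (in particular for `δ = δ_r`), and `S, T` are
disjoint with `|S| + |T| ≤ r`, then the spectral norm of `Φ_S* Φ_T` is at most `δ`:
`‖Φ_S* Φ_T y‖₂ ≤ δ ‖y‖₂` for all `y`. -/
theorem stmt6 (m d r : ℕ) (Φ : Matrix (Fin m) (Fin d) ℝ)
    (δ : ℝ) (hδ0 : 0 ≤ δ) (hΦ : RICq Φ r δ)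
    (S T : Finset (Fin d)) (hdisj : Disjoint S T) (hcard : S.card + T.card ≤ r) :
    ∀ y : {j // j ∈ T} → ℝ,
      l2 (((colSub Φ S).transpose * colSub Φ T).mulVec y) ≤ δ * l2 y := by
  intro y
  set z := ((colSub Φ S).transpose * colSub Φ T).mulVec y
  have hinner : (colSub Φ S).mulVec z ⬝ᵥ (colSub Φ T).mulVec y = z ⬝ᵥ z := by
    rw [← Matrix.vecMul_transpose, ← Matrix.dotProduct_mulVec, Matrix.mulVec_mulVec]
  have key := hΦ.two_mul_dotProduct_le hdisj hcard z y
  simp only [hinner, ← l2_sq] at key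
  have hy : 0 ≤ l2 y := Real.sqrt_nonneg _
  have hl : 0 ≤ l2 z := Real.sqrt_nonneg _
  refine (sq_le_sq₀ hl (mul_nonneg hδ0 hy)).mp ?_
  rcases hδ0.eq_or_lt with rfl | hδ
  · linarith [key 1 1]
  · refine le_of_mul_le_mul_left ?_ hδ
    linarith [key 1 δ]
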